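/- arXiv:0912.1131 — 2 statements merged into one kernel-verified Lean document; each statement's English description precedes it below -/
import Mathlib

section
/- Let n ≥ 1 be an integer, let K be a field whose characteristic does not divide n, containing a primitive n-th root of unity. Let α₀ ∈ K be nonzero, set a = α₀ⁿ, and let f ∈ K[w] be a polynomial with f(0) ≠ 0 and f(α⁻¹) ≠ 0 for every α ∈ K with αⁿ = a. Suppose A, B ∈ K[w] with deg A < n and deg B < deg f satisfy 1/((1 − a·wⁿ)·f(w)) = A(w)/(1 − a·wⁿ) + B(w)/f(w) in the field K(w). Then the constant coefficient of A equals the generalized Dedekind sum S_{f,a}(n), i.e., A(0) = (1/n)·∑_{α ∈ K, αⁿ = a} 1/f(α⁻¹). -/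
open Polynomial

/-- The sum of `α⁻¹ ^ i` over all `n`-th roots `α` of a nonzero `n`-th power is `0` for `0 < i < n`
and `n` for `i = 0`. -/
theorem IsPrimitiveRoot.sum_range_inv_pow {K : Type*} [Field K] {n : ℕ} {ζ : K}
    (hζ : IsPrimitiveRoot ζ n) (α₀ : K) {i : ℕ} (hi : i < n) :
    ∑ k ∈ Finset.range n, ((ζ ^ k * α₀)⁻¹) ^ i = if i = 0 then (n : K) else 0 := by
  split_ifs with h
  · simp [h]
  · have hne : (ζ⁻¹) ^ i ≠ 1 := hζ.inv.pow_ne_one_of_pos_of_lt h hi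
    have hgeom : ∑ k ∈ Finset.range n, ((ζ⁻¹) ^ i) ^ k = 0 := by
      rw [geom_sum_eq hne, ← pow_mul, mul_comm, pow_mul, hζ.inv.pow_eq_one]
      simp
    calc ∑ k ∈ Finset.range n, ((ζ ^ k * α₀)⁻¹) ^ i
        = ∑ k ∈ Finset.range n, ((ζ⁻¹) ^ i) ^ k * (α₀⁻¹) ^ i := by
          refine Finset.sum_congr rfl fun k _ => ?_
          rw [mul_inv, mul_pow, ← inv_pow, ← pow_mul, ← pow_mul, mul_comm k i]
      _ = 0 := by rw [← Finset.sum_mul, hgeom, zero_mul]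

/-- Summing a polynomial of degree less than `n` over the inverses of the `n`-th roots of a nonzero
`n`-th power gives `n` times its constant coefficient. -/
theorem IsPrimitiveRoot.sum_range_eval_inv {K : Type*} [Field K] {n : ℕ} {ζ : K}
    (hζ : IsPrimitiveRoot ζ n) (hn : 1 ≤ n) (α₀ : K) {A : K[X]} (hA : A.degree < n) :
    ∑ k ∈ Finset.range n, A.eval (ζ ^ k * α₀)⁻¹ = n * A.eval 0 := by
  have hnat : A.natDegree < n := by
    rcases eq_or_ne A 0 with rfl | h
    · simpa using Nat.pos_of_ne_zero (Nat.one_le_iff_ne_zero.1 hn)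
    · exact (natDegree_lt_iff_degree_lt h).2 hA
  simp_rw [eval_eq_sum_range' hnat]
  rw [Finset.sum_comm]
  simp_rw [← Finset.mul_sum]
  rw [Finset.sum_congr rfl fun i hi => by
    rw [hζ.sum_range_inv_pow α₀ (Finset.mem_range.1 hi)]]
  have h0 : 0 < n := hn
  simp [zero_pow_eq, h0, mul_comm]

theorem IsPrimitiveRoot.sum_nthRoots_toFinset {K M : Type*} [Field K] [DecidableEq K]
    [AddCommMonoid M] {n : ℕ} {ζ : K} (hζ : IsPrimitiveRoot ζ n) {α₀ : K} (hα₀ : α₀ ≠ 0)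
    (g : K → M) :
    ∑ α ∈ (nthRoots n (α₀ ^ n)).toFinset, g α = ∑ k ∈ Finset.range n, g (ζ ^ k * α₀) := by
  have himage : (nthRoots n (α₀ ^ n)).toFinset
      = (Finset.range n).image fun k => ζ ^ k * α₀ := by
    ext x
    simp [hζ.nthRoots_eq rfl]
  rw [himage, Finset.sum_image]
  intro i hi j hj hij
  exact hζ.pow_inj (by simpa using hi) (by simpa using hj) (mul_right_cancel₀ hα₀ hij)



/-- The constant term of the numerator over `1 - a·wⁿ` in the partial fraction
decomposition of `1/((1 - a·wⁿ)·f(w))` is the generalized Dedekind sum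
`S_{f,a}(n) = (1/n)·∑_{αⁿ = a} 1/f(α⁻¹)`. -/
theorem stmt5 {K : Type*} [Field K] [DecidableEq K] (n : ℕ) (hn : 1 ≤ n) (hchar : (n : K) ≠ 0)
    (ζ : K) (hζ : IsPrimitiveRoot ζ n)
    (α₀ : K) (hα₀ : α₀ ≠ 0) (a : K) (ha : a = α₀ ^ n)
    (f : K[X]) (hf0 : f.eval 0 ≠ 0)
    (hf : ∀ α : K, α ^ n = a → f.eval α⁻¹ ≠ 0)
    (A B : K[X]) (hA : A.degree < n) (hB : B.degree < f.degree)
    (heq : (1 : RatFunc K) / (algebraMap K[X] (RatFunc K) ((1 - C a * X ^ n) * f))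
        = (algebraMap K[X] (RatFunc K) A) / (algebraMap K[X] (RatFunc K) (1 - C a * X ^ n))
          + (algebraMap K[X] (RatFunc K) B) / (algebraMap K[X] (RatFunc K) f)) :
    A.eval 0 = (n : K)⁻¹ * ∑ α ∈ (Polynomial.nthRoots n a).toFinset, (f.eval α⁻¹)⁻¹ := by
  have hf' : f ≠ 0 := by
    rintro rfl
    simp at hf0
  have hg : (1 - C a * X ^ n : K[X]) ≠ 0 := by
    intro h
    have := congrArg (eval 0) h
    simp [zero_pow (Nat.one_le_iff_ne_zero.1 hn)] at this
  have hpoly : 1 = A * f + B * (1 - C a * X ^ n) := by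
    have hF := RatFunc.algebraMap_ne_zero hf'
    have hG := RatFunc.algebraMap_ne_zero hg
    apply RatFunc.algebraMap_injective K
    rw [div_add_div _ _ hG hF, map_mul, div_left_inj' (mul_ne_zero hG hF)] at heq
    rw [map_one, heq, map_add, map_mul, map_mul, mul_comm (algebraMap K[X] (RatFunc K) B)]
  have heval : ∀ α ∈ (nthRoots n a).toFinset, (f.eval α⁻¹)⁻¹ = A.eval α⁻¹ := by
    intro α hα
    have hαn : α ^ n = a := by
      simpa [mem_nthRoots (Nat.lt_of_lt_of_le Nat.zero_lt_one hn)] using hα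
    have ha0 : a ≠ 0 := ha ▸ pow_ne_zero n hα₀
    have h := congrArg (eval α⁻¹) hpoly
    simp only [eval_one, eval_add, eval_mul, eval_sub, eval_C, eval_pow, eval_X, inv_pow, hαn,
      mul_inv_cancel₀ ha0, sub_self, mul_zero, add_zero] at h
    exact (eq_inv_of_mul_eq_one_left h.symm).symm
  rw [Finset.sum_congr rfl heval, ha, hζ.sum_nthRoots_toFinset hα₀ fun α => A.eval α⁻¹,
    hζ.sum_range_eval_inv hn α₀ hA, inv_mul_cancel_left₀ hchar]
end

section
/- Let n ≥ 1 be an integer, K a field whose characteristic does not divide n, containing a primitive n-th root of unity. Let α₀ ∈ K be nonzero, set a = α₀ⁿ, and let f ∈ K[w] be a polynomial with f(α⁻¹) ≠ 0 for every α ∈ K with αⁿ = a. Then there exists B ∈ K[w] with deg B < deg f such that in K(w): 1/((1 − a·wⁿ)·f(w)) = ∑_{α ∈ K, αⁿ = a} (1/(n·f(α⁻¹)))·(1/(1 − α·w)) + B(w)/f(w). In other words, in the partial fraction decomposition of 1/((1 − a·wⁿ)f(w)) with respect to the linear factors 1 − α·w of 1 − a·wⁿ, the numerator at the factor 1 − α·w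 equals 1/(n·f(α⁻¹)). -/
open Polynomial

/-- If `p` and `q` both vanish on a finite set with at least `deg p` elements,
then `p` divides `q`. -/
theorem dvd_of_eval_eq_zero_of_degree_le_card {K : Type*} [Field K] {p q : K[X]} (hp : p ≠ 0)
    (s : Finset K) (hs : p.degree ≤ s.card) (hps : ∀ x ∈ s, p.eval x = 0)
    (hqs : ∀ x ∈ s, q.eval x = 0) : p ∣ q := by
  rw [← EuclideanDomain.mod_eq_zero]
  refine eq_zero_of_degree_lt_of_eval_finset_eq_zero s
    ((EuclideanDomain.mod_lt q hp).trans_le hs) fun x hx => ?_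
  have h := congrArg (eval x) (EuclideanDomain.div_add_mod q p)
  simpa [hps x hx, hqs x hx] using h

/-- The geometric sum in `α * X` vanishes at the inverse of every other `n`-th root of `α ^ n`,
and equals `n` at `α⁻¹`. -/
theorem eval_inv_geom_sum_of_pow_eq {K : Type*} [Field K] [DecidableEq K] {n : ℕ} {α β : K}
    (hβ : β ≠ 0) (h : α ^ n = β ^ n) :
    (∑ i ∈ Finset.range n, (C α * X) ^ i : K[X]).eval β⁻¹ = if α = β then (n : K) else 0 := by
  rw [eval_finsetSum]
  simp only [eval_pow, eval_mul, eval_C, eval_X]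
  split_ifs with hαβ
  · simp [hαβ, hβ]
  · have hne : α * β⁻¹ ≠ 1 := fun h1 => hαβ (by field_simp at h1; exact h1)
    rw [geom_sum_eq hne, mul_pow, h, ← mul_pow, mul_inv_cancel₀ hβ]
    simp

theorem degree_geom_sum_C_mul_X_lt {K : Type*} [Field K] (n : ℕ) (α : K) :
    (∑ i ∈ Finset.range n, (C α * X) ^ i : K[X]).degree < n := by
  rw [← mem_degreeLT]
  refine Submodule.sum_mem _ fun i hi => mem_degreeLT.2 ?_
  rw [mul_pow, ← C_pow]
  exact (degree_C_mul_X_pow_le i _).trans_lt (by exact_mod_cast Finset.mem_range.1 hi)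

/-- In the partial fraction decomposition of `1/((1 - a·wⁿ)·f(w))` with respect to the
linear factors `1 - α·w` of `1 - a·wⁿ`, the numerator at `1 - α·w` equals
`1/(n·f(α⁻¹))`. -/
theorem stmt8 {K : Type*} [Field K] [DecidableEq K]
    (n : ℕ) (hn : 1 ≤ n) (hchar : (n : K) ≠ 0)
    (ζ : K) (hζ : IsPrimitiveRoot ζ n)
    (α₀ : K) (hα₀ : α₀ ≠ 0) (a : K) (ha : a = α₀ ^ n)
    (f : K[X]) (hf : ∀ α : K, α ^ n = a → f.eval α⁻¹ ≠ 0) :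
    ∃ B : K[X], B.degree < f.degree ∧
      (1 : RatFunc K) / (algebraMap K[X] (RatFunc K) ((1 - C a * X ^ n) * f))
        = (∑ α ∈ (Polynomial.nthRoots n a).toFinset,
            RatFunc.C (((n : K) * f.eval α⁻¹)⁻¹) / (algebraMap K[X] (RatFunc K) (1 - C α * X)))
          + (algebraMap K[X] (RatFunc K) B) / (algebraMap K[X] (RatFunc K) f) := by
  have ha0 : a ≠ 0 := ha ▸ pow_ne_zero n hα₀
  set S := (nthRoots n a).toFinset with hS
  have memS (α : K) : α ∈ S ↔ α ^ n = a := by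
    rw [hS, Multiset.mem_toFinset, mem_nthRoots hn]
  have ne0 {α : K} (h : α ∈ S) : α ≠ 0 := by
    rintro rfl
    exact ha0 (by rw [← (memS 0).1 h, zero_pow (by omega)])
  have cardS : S.card = n := by
    rw [hS, Multiset.toFinset_card_of_nodup (hζ.nthRoots_nodup ha0), hζ.card_nthRoots,
      if_pos ⟨α₀, ha.symm⟩]
  have hf0 : f ≠ 0 := by
    rintro rfl
    exact hf α₀ ha.symm (by simp)
  set P : K[X] := 1 - C a * X ^ n with hP
  have degP : P.degree = n := by
    rw [hP, degree_sub_eq_right_of_degree_lt, degree_C_mul_X_pow n ha0]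
    rw [degree_C_mul_X_pow n ha0, degree_one]
    exact_mod_cast hn
  have hP0 : P ≠ 0 := by
    rintro h
    simp [h] at degP
  let c (α : K) : K := ((n : K) * f.eval α⁻¹)⁻¹
  let Q (α : K) : K[X] := ∑ i ∈ Finset.range n, (C α * X) ^ i
  have hQ {α : K} (h : α ∈ S) : (1 - C α * X) * Q α = P := by
    rw [mul_neg_geom_sum, mul_pow, ← C_pow, (memS α).1 h]
  set N : K[X] := ∑ α ∈ S, C (c α) * Q α with hN
  have degN : N.degree < n := by
    rw [← mem_degreeLT]
    refine Submodule.sum_mem _ fun α _ => ?_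
    rw [← smul_eq_C_mul]
    exact Submodule.smul_mem _ _ (mem_degreeLT.2 (degree_geom_sum_C_mul_X_lt n α))
  have evalN {β : K} (h : β ∈ S) : N.eval β⁻¹ = c β * n := by
    rw [hN, eval_finsetSum, Finset.sum_eq_single_of_mem β h]
    · rw [eval_mul, eval_C, eval_inv_geom_sum_of_pow_eq (ne0 h) rfl, if_pos rfl]
    · intro α hα hne
      rw [eval_mul, eval_inv_geom_sum_of_pow_eq (ne0 h) (by rw [(memS α).1 hα, (memS β).1 h]),
        if_neg hne, mul_zero]
  obtain ⟨B, hB⟩ : P ∣ 1 - f * N := by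
    refine dvd_of_eval_eq_zero_of_degree_le_card hP0 (S.image (·⁻¹)) ?_ ?_ ?_
    · rw [degP, Finset.card_image_of_injective _ inv_injective, cardS]
    · simp only [Finset.forall_mem_image]
      intro β hβ
      simp [hP, (memS β).1 hβ, ha0]
    · simp only [Finset.forall_mem_image]
      intro β hβ
      rw [eval_sub, eval_one, eval_mul, evalN hβ, mul_left_comm, mul_comm (eval _ f),
        inv_mul_cancel₀ (mul_ne_zero hchar (hf β ((memS β).1 hβ))), sub_self]
  refine ⟨B, ?_, ?_⟩
  · rcases eq_or_ne B 0 with rfl | hB0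
    · rw [degree_zero, bot_lt_iff_ne_bot]
      exact degree_ne_bot.2 hf0
    have hlt : (P * B).degree < (n + f.natDegree : ℕ) := by
      rw [← hB, ← mem_degreeLT]
      refine Submodule.sub_mem _ (mem_degreeLT.2 ?_) (mem_degreeLT.2 ?_)
      · rw [degree_one]
        exact_mod_cast (by omega : 0 < n + f.natDegree)
      · rcases eq_or_ne N 0 with h0 | h0
        · simp [h0]
        rw [degree_eq_natDegree h0] at degN
        rw [degree_mul, degree_eq_natDegree hf0, degree_eq_natDegree h0]
        norm_cast at degN ⊢
        omega
    rw [degree_mul, degP, degree_eq_natDegree hB0] at hlt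
    rw [degree_eq_natDegree hB0, degree_eq_natDegree hf0]
    norm_cast at hlt ⊢
    omega
  · have inj {p : K[X]} (hp : p ≠ 0) : algebraMap K[X] (RatFunc K) p ≠ 0 :=
      RatFunc.algebraMap_ne_zero hp
    have hsum : ∑ α ∈ S, RatFunc.C (c α) / algebraMap K[X] (RatFunc K) (1 - C α * X)
        = algebraMap K[X] (RatFunc K) N / algebraMap K[X] (RatFunc K) P := by
      rw [hN, map_sum, Finset.sum_div]
      refine Finset.sum_congr rfl fun α hα => ?_
      have hne := hP0
      rw [← hQ hα] at hne ⊢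
      rw [map_mul, map_mul, RatFunc.algebraMap_C,
        mul_div_mul_right _ _ (inj (right_ne_zero_of_mul hne))]
    rw [hsum, div_add_div _ _ (inj hP0) (inj hf0), ← map_mul, ← map_mul, ← map_mul, ← map_add,
      ← hB, mul_comm N f, add_sub_cancel, map_one]
end
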